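/- Let R be a curvature-type tensor on ℂⁿ (with the Kähler symmetries) satisfying (k-1)|Y|² Ric(Y,Ȳ) + (n-k) R(Y,Ȳ,Y,Ȳ) ≤ -(n-1)(k+1)σ |Y|⁴ for all Y ∈ ℂⁿ. Let λ₁,…,λₙ > 0 be positive reals, set G = Σᵢ λᵢ, and for a unitary basis {wᵢ} of ℂⁿ write Rᵢⱼ̄ₖₗ̄ = R(wᵢ, w̄ⱼ, wₖ, w̄ₗ) and Ricₛₛ̄ = Ric(wₛ, w̄ₛ). Then 2(n-k) Σ_{i,j} R_{iīj j̄} λᵢλⱼ + (k-1) G Σₛ Ricₛₛ̄ λₛ + (k-1) Σᵢ Ric_{iī} λᵢ² ≤ -(n-1)(k+1)σ (G² + Σᵢ λᵢ²). -/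

import Mathlib

open Finset

/-- A complex-valued function of four vectors which is linear in the first and third slots and
conjugate-linear in the second and fourth ones. -/
structure IsSesquiquadrilinear {E : Type*} [AddCommGroup E] [Module ℂ E]
    (T : E → E → E → E → ℂ) : Prop where
  add₁ : ∀ X X' Y Z W, T (X + X') Y Z W = T X Y Z W + T X' Y Z W
  smul₁ : ∀ (c : ℂ) X Y Z W, T (c • X) Y Z W = c * T X Y Z W
  add₂ : ∀ X Y Y' Z W, T X (Y + Y') Z W = T X Y Z W + T X Y' Z W
  smul₂ : ∀ (c : ℂ) X Y Z W, T X (c • Y) Z W = (starRingEnd ℂ) c * T X Y Z W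
  add₃ : ∀ X Y Z Z' W, T X Y (Z + Z') W = T X Y Z W + T X Y Z' W
  smul₃ : ∀ (c : ℂ) X Y Z W, T X Y (c • Z) W = c * T X Y Z W
  add₄ : ∀ X Y Z W W', T X Y Z (W + W') = T X Y Z W + T X Y Z W'
  smul₄ : ∀ (c : ℂ) X Y Z W, T X Y Z (c • W) = (starRingEnd ℂ) c * T X Y Z W

/-- Eight times the mean of `f (Y + z • e)` over a random `z` which is `0` with probability `1/2`
and each of `±1 ± i` with probability `1/8`. The moments of `z` of order at most `(2, 2)` are those
of a standard complex Gaussian variable. -/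
noncomputable def gaussianDesignSum {E : Type*} [AddCommGroup E] [Module ℂ E]
    (e : E) (f : E → ℂ) (Y : E) : ℂ :=
  4 * f Y + (f (Y + (1 + Complex.I) • e) + f (Y + (-(1 + Complex.I)) • e)
    + f (Y + (1 - Complex.I) • e) + f (Y + (-(1 - Complex.I)) • e))

section GaussianDesign

variable {E : Type*} [AddCommGroup E] [Module ℂ E]

theorem gaussianDesignSum_sum {ι : Type*} (s : Finset ι) (f : ι → E → ℂ) (e Y : E) :
    gaussianDesignSum e (fun X => ∑ i ∈ s, f i X) Y
      = ∑ i ∈ s, gaussianDesignSum e (f i) Y := by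
  simp only [gaussianDesignSum, mul_sum, sum_add_distrib]

theorem gaussianDesignSum_add (f g : E → ℂ) (e Y : E) :
    gaussianDesignSum e (fun X => f X + g X) Y
      = gaussianDesignSum e f Y + gaussianDesignSum e g Y := by
  simp only [gaussianDesignSum]
  ring

theorem gaussianDesignSum_const (c : ℂ) (e Y : E) :
    gaussianDesignSum e (fun _ => c) Y = 8 * c := by
  simp only [gaussianDesignSum]
  ring

theorem gaussianDesignSum_re_nonpos {f : E → ℂ} (hf : ∀ Y, (f Y).re ≤ 0) (e Y : E) :
    (gaussianDesignSum e f Y).re ≤ 0 := by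
  have h : (gaussianDesignSum e f Y).re = 4 * (f Y).re
      + ((f (Y + (1 + Complex.I) • e)).re + (f (Y + (-(1 + Complex.I)) • e)).re
      + (f (Y + (1 - Complex.I) • e)).re + (f (Y + (-(1 - Complex.I)) • e)).re) := by
    simp [gaussianDesignSum]
  rw [h]
  linarith [hf Y, hf (Y + (1 + Complex.I) • e), hf (Y + (-(1 + Complex.I)) • e),
    hf (Y + (1 - Complex.I) • e), hf (Y + (-(1 - Complex.I)) • e)]

theorem gaussianDesignSum_sesquilinear {B : E → E → ℂ}
    (add₁ : ∀ X X' Y, B (X + X') Y = B X Y + B X' Y)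
    (smul₁ : ∀ (c : ℂ) X Y, B (c • X) Y = c * B X Y)
    (add₂ : ∀ X Y Y', B X (Y + Y') = B X Y + B X Y')
    (smul₂ : ∀ (c : ℂ) X Y, B X (c • Y) = (starRingEnd ℂ) c * B X Y) (e Y : E) :
    gaussianDesignSum e (fun X => B X X) Y = 8 * (B Y Y + B e e) := by
  simp only [gaussianDesignSum, add₁, smul₁, add₂, smul₂, map_neg, map_add, map_sub, map_one,
    Complex.conj_I]
  linear_combination (-4 * B e e) * Complex.I_sq

namespace IsSesquiquadrilinear

variable {T : E → E → E → E → ℂ}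

theorem gaussianDesignSum_diag (hT : IsSesquiquadrilinear T) (e Y : E) :
    gaussianDesignSum e (fun X => T X X X X) Y
      = 8 * (T Y Y Y Y + (T e e Y Y + T e Y Y e + T Y e e Y + T Y Y e e) + 2 * T e e e e) := by
  obtain ⟨a, b, hab, hsq, ha, hb, hac, hbc⟩ : ∃ a b : ℂ, a * b = 2 ∧ a ^ 2 + b ^ 2 = 0 ∧
      1 + Complex.I = a ∧ 1 - Complex.I = b ∧ (starRingEnd ℂ) a = b ∧ (starRingEnd ℂ) b = a := by
    refine ⟨1 + Complex.I, 1 - Complex.I, ?_, ?_, rfl, rfl, ?_, ?_⟩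
    · linear_combination -Complex.I_sq
    · linear_combination 2 * Complex.I_sq
    · simp [sub_eq_add_neg]
    · simp
  simp only [gaussianDesignSum, ha, hb, hT.add₁, hT.smul₁, hT.add₂, hT.smul₂, hT.add₃, hT.smul₃,
    hT.add₄, hT.smul₄, map_neg, hac, hbc]
  linear_combination
    (4 * (T e e Y Y + T e Y Y e + T Y e e Y + T Y Y e e) + 4 * (a * b + 2) * T e e e e) * hab
      + 2 * (T e Y e Y + T Y e Y e) * hsq

/-- The Gaussian average of `T (Y + Z) (Y + Z) (Y + Z) (Y + Z)`, where `Z = ∑ i ∈ s, zᵢ • eᵢ`,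
inherits the sign of the quartic form, by averaging over one coordinate at a time. -/
theorem re_gaussian_average_nonpos (hT : IsSesquiquadrilinear T)
    (hneg : ∀ Y, (T Y Y Y Y).re ≤ 0) {ι : Type*} (e : ι → E) (s : Finset ι) (Y : E) :
    (T Y Y Y Y
      + ∑ i ∈ s, (T (e i) (e i) Y Y + T (e i) Y Y (e i) + T Y (e i) (e i) Y + T Y Y (e i) (e i))
      + ∑ i ∈ s, ∑ j ∈ s, (T (e i) (e i) (e j) (e j) + T (e i) (e j) (e j) (e i))).re ≤ 0 := by
  classical
  induction s using Finset.induction_on generalizing Y with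
  | empty => simpa using hneg Y
  | insert a s ha ih =>
    have h := gaussianDesignSum_re_nonpos ih (e a) Y
    have hterm : ∀ i, gaussianDesignSum (e a) (fun X => T (e i) (e i) X X + T (e i) X X (e i)
        + T X (e i) (e i) X + T X X (e i) (e i)) Y
        = 8 * (T (e i) (e i) Y Y + T (e i) Y Y (e i) + T Y (e i) (e i) Y + T Y Y (e i) (e i))
          + 8 * (T (e i) (e i) (e a) (e a) + T (e i) (e a) (e a) (e i)
          + T (e a) (e i) (e i) (e a) + T (e a) (e a) (e i) (e i)) := by
      intro i
      rw [gaussianDesignSum_add, gaussianDesignSum_add, gaussianDesignSum_add,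
        gaussianDesignSum_sesquilinear (B := fun X Y => T (e i) (e i) X Y)
          (by simp [hT.add₃]) (by simp [hT.smul₃]) (by simp [hT.add₄]) (by simp [hT.smul₄]),
        gaussianDesignSum_sesquilinear (B := fun X Y => T (e i) Y X (e i))
          (by simp [hT.add₃]) (by simp [hT.smul₃]) (by simp [hT.add₂]) (by simp [hT.smul₂]),
        gaussianDesignSum_sesquilinear (B := fun X Y => T X (e i) (e i) Y)
          (by simp [hT.add₁]) (by simp [hT.smul₁]) (by simp [hT.add₄]) (by simp [hT.smul₄]),
        gaussianDesignSum_sesquilinear (B := fun X Y => T X Y (e i) (e i))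
          (by simp [hT.add₁]) (by simp [hT.smul₁]) (by simp [hT.add₂]) (by simp [hT.smul₂])]
      ring
    rw [gaussianDesignSum_add, gaussianDesignSum_add, gaussianDesignSum_const,
      gaussianDesignSum_sum, hT.gaussianDesignSum_diag, sum_congr rfl fun i _ => hterm i] at h
    refine nonpos_of_mul_nonpos_right (a := (8 : ℝ)) (le_of_eq_of_le ?_ h) (by norm_num)
    rw [← Complex.re_ofReal_mul]
    congr 1
    simp only [sum_insert ha, sum_add_distrib, ← mul_sum]
    push_cast
    ring

/-- If the quartic form of `T` has nonpositive real part, then so does its Gaussian average. -/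
theorem re_sum_sum_nonpos (hT : IsSesquiquadrilinear T)
    (hneg : ∀ Y, (T Y Y Y Y).re ≤ 0) {ι : Type*} (e : ι → E) (s : Finset ι) :
    (∑ i ∈ s, ∑ j ∈ s, (T (e i) (e i) (e j) (e j) + T (e i) (e j) (e j) (e i))).re ≤ 0 := by
  have h₁ : ∀ Y Z W, T 0 Y Z W = 0 := fun Y Z W => by simpa using hT.smul₁ 0 0 Y Z W
  have h₂ : ∀ X Z W, T X 0 Z W = 0 := fun X Z W => by simpa using hT.smul₂ 0 X 0 Z W
  have h₃ : ∀ X Y W, T X Y 0 W = 0 := fun X Y W => by simpa using hT.smul₃ 0 X Y 0 W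
  simpa [h₁, h₂, h₃] using hT.re_gaussian_average_nonpos hneg e s 0

end IsSesquiquadrilinear

end GaussianDesign

/-- Eigenvalue form of Lemma 2.2 of Chu–Lee–Tam: if a Kähler curvature-type tensor `R`
on `ℂⁿ` satisfies `(k-1)|Y|² Ric(Y,Ȳ) + (n-k) R(Y,Ȳ,Y,Ȳ) ≤ -(n-1)(k+1)σ |Y|⁴` for all
`Y`, then for any unitary basis `{wᵢ}` and positive reals `λᵢ` with `G = Σ λᵢ`,
`2(n-k) Σ R_{iīj j̄} λᵢλⱼ + (k-1) G Σ Ric_{ss̄} λₛ + (k-1) Σ Ric_{iī} λᵢ²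
  ≤ -(n-1)(k+1)σ (G² + Σ λᵢ²)`. -/
theorem quartic_ineq_eigenvalue_form (n k : ℕ) (hk : 1 < k) (hkn : k < n)
    (σ : ℝ) (hσ : 0 ≤ σ)
    (R : EuclideanSpace ℂ (Fin n) → EuclideanSpace ℂ (Fin n) →
          EuclideanSpace ℂ (Fin n) → EuclideanSpace ℂ (Fin n) → ℂ)
    (hadd1 : ∀ X X' Y Z W, R (X + X') Y Z W = R X Y Z W + R X' Y Z W)
    (hsmul1 : ∀ (c : ℂ) X Y Z W, R (c • X) Y Z W = c * R X Y Z W)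
    (hadd2 : ∀ X Y Y' Z W, R X (Y + Y') Z W = R X Y Z W + R X Y' Z W)
    (hsmul2 : ∀ (c : ℂ) X Y Z W, R X (c • Y) Z W = (starRingEnd ℂ) c * R X Y Z W)
    (hsym1 : ∀ X Y Z W, R X Y Z W = R Z Y X W)
    (hsym2 : ∀ X Y Z W, R X Y Z W = R Z W X Y)
    (hconj : ∀ X Y Z W, (starRingEnd ℂ) (R X Y Z W) = R Y X W Z)
    (w : Fin n → EuclideanSpace ℂ (Fin n)) (hw : Orthonormal ℂ w)
    (Ric : EuclideanSpace ℂ (Fin n) → EuclideanSpace ℂ (Fin n) → ℂ)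
    (hRic : ∀ X Y, Ric X Y = ∑ t : Fin n, R X Y (w t) (w t))
    (hquartic : ∀ Y : EuclideanSpace ℂ (Fin n),
      ((k : ℝ) - 1) * ‖Y‖ ^ 2 * (Ric Y Y).re + ((n : ℝ) - k) * (R Y Y Y Y).re
        ≤ -((n : ℝ) - 1) * ((k : ℝ) + 1) * σ * ‖Y‖ ^ 4)
    (lam : Fin n → ℝ) (hlam : ∀ i, 0 < lam i) (G : ℝ) (hG : G = ∑ i, lam i) :
    2 * ((n : ℝ) - k) * ∑ i : Fin n, ∑ j : Fin n,
        (R (w i) (w i) (w j) (w j)).re * lam i * lam j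
      + ((k : ℝ) - 1) * G * ∑ s : Fin n, (Ric (w s) (w s)).re * lam s
      + ((k : ℝ) - 1) * ∑ i : Fin n, (Ric (w i) (w i)).re * lam i ^ 2
      ≤ -((n : ℝ) - 1) * ((k : ℝ) + 1) * σ * (G ^ 2 + ∑ i : Fin n, lam i ^ 2) := by
  have hadd3 : ∀ X Y Z Z' W, R X Y (Z + Z') W = R X Y Z W + R X Y Z' W := fun X Y Z Z' W => by
    rw [hsym2, hadd1, hsym2 Z, hsym2 Z']
  have hsmul3 : ∀ (c : ℂ) X Y Z W, R X Y (c • Z) W = c * R X Y Z W := fun c X Y Z W => by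
    rw [hsym2, hsmul1, hsym2 Z]
  have hadd4 : ∀ X Y Z W W', R X Y Z (W + W') = R X Y Z W + R X Y Z W' := fun X Y Z W W' => by
    rw [hsym2, hadd2, hsym2 Z, hsym2 Z]
  have hsmul4 : ∀ (c : ℂ) X Y Z W, R X Y Z (c • W) = (starRingEnd ℂ) c * R X Y Z W :=
    fun c X Y Z W => by rw [hsym2, hsmul2, hsym2 Z]
  obtain ⟨p, hp⟩ : ∃ p : ℝ, p = (k : ℝ) - 1 := ⟨_, rfl⟩
  obtain ⟨q, hq⟩ : ∃ q : ℝ, q = (n : ℝ) - k := ⟨_, rfl⟩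
  obtain ⟨c, hc⟩ : ∃ c : ℝ, c = -((n : ℝ) - 1) * ((k : ℝ) + 1) * σ := ⟨_, rfl⟩
  rw [← hp, ← hq, ← hc]
  simp only [← hp, ← hq, ← hc] at hquartic
  let T : EuclideanSpace ℂ (Fin n) → EuclideanSpace ℂ (Fin n) →
      EuclideanSpace ℂ (Fin n) → EuclideanSpace ℂ (Fin n) → ℂ := fun X Y Z W =>
    p * inner ℂ Y X * Ric Z W + q * R X Y Z W - c * inner ℂ Y X * inner ℂ W Z
  have hT : IsSesquiquadrilinear T := by
    constructor <;> intros <;>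
      simp only [T, hRic, hadd1, hadd2, hadd3, hadd4, hsmul1, hsmul2, hsmul3, hsmul4,
        inner_add_left, inner_add_right, inner_smul_left, inner_smul_right, sum_add_distrib,
        ← mul_sum] <;> ring
  have hneg : ∀ Y, (T Y Y Y Y).re ≤ 0 := by
    intro Y
    have hre : (T Y Y Y Y).re
        = p * ‖Y‖ ^ 2 * (Ric Y Y).re + q * (R Y Y Y Y).re - c * ‖Y‖ ^ 4 := by
      simp only [T, inner_self_eq_norm_sq_to_K, Complex.coe_algebraMap]
      norm_cast
      simp only [Complex.sub_re, Complex.add_re, Complex.re_ofReal_mul, Complex.ofReal_re]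
      ring
    rw [hre]
    linarith [hquartic Y]
  have hinner : ∀ i j, inner ℂ (w i) (w j) = if i = j then (1 : ℂ) else 0 :=
    orthonormal_iff_ite.mp hw
  have hsqrt : ∀ i, ((√(lam i) : ℝ) : ℂ) * (√(lam i) : ℝ) = lam i := fun i => by
    rw [← Complex.ofReal_mul, Real.mul_self_sqrt (hlam i).le]
  have hterm : ∀ i j, T ((√(lam i) : ℂ) • w i) ((√(lam i) : ℂ) • w i) ((√(lam j) : ℂ) • w j)
        ((√(lam j) : ℂ) • w j)
      + T ((√(lam i) : ℂ) • w i) ((√(lam j) : ℂ) • w j) ((√(lam j) : ℂ) • w j)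
        ((√(lam i) : ℂ) • w i)
      = ((lam i * lam j : ℝ) : ℂ) * (p * Ric (w j) (w j) + 2 * q * R (w i) (w i) (w j) (w j) - c)
        + if i = j then ((lam i ^ 2 : ℝ) : ℂ) * (p * Ric (w i) (w i) - c) else 0 := by
    intro i j
    rw [hT.smul₁, hT.smul₂, hT.smul₃, hT.smul₄, hT.smul₁, hT.smul₂, hT.smul₃, hT.smul₄]
    simp only [Complex.conj_ofReal, T, hinner]
    rw [hsym1 (w i) (w j) (w j) (w i), hsym2 (w j) (w j)]
    have hfac : ∀ A B : ℂ, (√(lam i) : ℂ) * (√(lam i) * (√(lam j) * (√(lam j) * A)))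
        + (√(lam i) : ℂ) * (√(lam j) * (√(lam j) * (√(lam i) * B))) = lam i * lam j * (A + B) := by
      intro A B
      rw [← hsqrt i, ← hsqrt j]
      ring
    rw [hfac]
    push_cast
    by_cases hij : i = j
    · subst hij
      simp only [if_true]
      ring
    · simp only [if_neg hij, if_neg (Ne.symm hij)]
      ring
  have h := hT.re_sum_sum_nonpos hneg (fun i => (√(lam i) : ℂ) • w i) univ
  simp only [hterm, sum_add_distrib, sum_ite_eq, mem_univ, if_true] at h
  rw [Complex.add_re] at h
  simp only [Complex.re_sum, Complex.re_ofReal_mul, Complex.sub_re, Complex.add_re,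
    Complex.ofReal_re, mul_assoc, Complex.re_ofNat, Complex.im_ofNat, Complex.mul_re (2 : ℂ),
    zero_mul, sub_zero] at h
  have hR : ∑ i, ∑ j, lam i * (lam j * (p * (Ric (w j) (w j)).re
      + 2 * (q * (R (w i) (w i) (w j) (w j)).re) - c))
      = p * G * ∑ s, (Ric (w s) (w s)).re * lam s
        + 2 * q * ∑ i, ∑ j, (R (w i) (w i) (w j) (w j)).re * lam i * lam j - c * G ^ 2 := by
    rw [hG, mul_assoc p, sum_mul_sum, pow_two, sum_mul_sum]
    simp only [mul_sum, ← sum_add_distrib, ← sum_sub_distrib]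
    exact sum_congr rfl fun i _ => sum_congr rfl fun j _ => by ring
  have hdiag : ∑ i, lam i ^ 2 * (p * (Ric (w i) (w i)).re - c)
      = p * ∑ i, (Ric (w i) (w i)).re * lam i ^ 2 - c * ∑ i, lam i ^ 2 := by
    simp only [mul_sum, ← sum_sub_distrib]
    exact sum_congr rfl fun i _ => by ring
  rw [hR, hdiag] at h
  linarith
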